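/- Let A = [a_0, a_1, …, a_n] be a nonempty list of integers, let Ā = [−a_n, −a_{n−1}, …, −a_0] be the reverse of A with all entries negated, and let c be any integer. Then N(c :: Ā ++ [0] ++ A) = 1 and D(c :: Ā ++ [0] ++ A) = 0; that is, the continued fraction [c; −a_n, …, −a_0, 0, a_0, …, a_n] represents 1/0, independently of c. -/

import Mathlib

/-- Numerator/denominator pair of the continued fraction determined by a list:
`cfND [] = (1, 0)`, `cfND (a :: L) = (a * N L + D L, N L)`. -/
def cfND : List ℤ → ℤ × ℤ
  | [] => (1, 0)
  | a :: L => (a * (cfND L).1 + (cfND L).2, (cfND L).1)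

/-- Numerator `N` of the continued fraction of a list. -/
def cfN (L : List ℤ) : ℤ := (cfND L).1

/-- Denominator `D` of the continued fraction of a list. -/
def cfD (L : List ℤ) : ℤ := (cfND L).2

/-- The Rolfsen operation `R₊(m)(p, q) = (p + m·q, q)`. -/
def Rpos (m : ℤ) (pq : ℤ × ℤ) : ℤ × ℤ := (pq.1 + m * pq.2, pq.2)

/-- The Rolfsen operation `R₋(m)(p, q) = (p, q + m·p)`. -/
def Rneg (m : ℤ) (pq : ℤ × ℤ) : ℤ × ℤ := (pq.1, pq.2 + m * pq.1)

theorem cfND_append_congr (P L L' : List ℤ) (h : cfND L = cfND L') :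
    cfND (P ++ L) = cfND (P ++ L') := by
  induction P with
  | nil => simpa using h
  | cons a P ih => simp [cfND, ih]

theorem cfND_palin (A : List ℤ) :
    cfND ((A.map fun x => -x).reverse ++ ([0] ++ A)) = (0, 1) := by
  induction A with
  | nil => simp [cfND]
  | cons a A ih =>
    rw [← ih, List.map_cons, List.reverse_cons, List.append_assoc]
    apply cfND_append_congr
    simp [cfND]

theorem palindrome_infty (A : List ℤ) (hA : A ≠ []) (c : ℤ) :
    cfN (c :: ((A.map fun x => -x).reverse ++ [0] ++ A)) = 1 ∧
    cfD (c :: ((A.map fun x => -x).reverse ++ [0] ++ A)) = 0 := by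
  have h := cfND_palin A
  rw [← List.append_assoc] at h
  simp only [cfN, cfD, cfND, h]
  simp
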